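/- arXiv:2509.13617 — 3 statements merged into one kernel-verified Lean document; each statement's English description precedes it below -/
import Mathlib

section
/- Let R be an integral domain. Then R is a PvMD if and only if for every R-module M, the torsion submodule T(M) is a w-pure submodule of M, i.e., for every R-module L the kernel of the induced map L ⊗_R T(M) → L ⊗_R M is GV-torsion. -/
open TensorProduct

/-- A finitely generated ideal `J` is a GV-ideal if the natural map
`R → Hom_R(J, R)`, sending `r` to multiplication by `r`, is bijective. -/
def IsGVIdeal {R : Type*} [CommRing R] (J : Ideal R) : Prop :=
  J.FG ∧ Function.Bijective fun r : R => (r • J.subtype : J →ₗ[R] R)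

/-- An element `m` of an `R`-module is a GV-torsion element if it is
annihilated by some GV-ideal. -/
def IsGVTorsionElem (R : Type*) [CommRing R] {M : Type*} [AddCommGroup M] [Module R M]
    (m : M) : Prop :=
  ∃ J : Ideal R, IsGVIdeal J ∧ ∀ j ∈ J, j • m = 0

/-- `R` is a PvMD if for every nonzero finitely generated ideal `I` of `R` there is a
GV-ideal `J` with `J ⊆ I·I⁻¹` (inside the quotient field `K`). -/
def IsPvMD (R : Type*) [CommRing R] [IsDomain R] (K : Type*) [Field K] [Algebra R K]
    [IsFractionRing R K] : Prop :=
  ∀ I : Ideal R, I ≠ ⊥ → I.FG →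
    ∃ J : Ideal R, IsGVIdeal J ∧
      (J : FractionalIdeal (nonZeroDivisors R) K) ≤
        (I : FractionalIdeal (nonZeroDivisors R) K) *
          (I : FractionalIdeal (nonZeroDivisors R) K)⁻¹

section GVIdeal

variable {R : Type*} [CommRing R]

theorem isGVIdeal_top : IsGVIdeal (⊤ : Ideal R) := by
  refine ⟨⟨{1}, by simp⟩, fun r s h => ?_, fun f => ⟨f ⟨1, trivial⟩, ?_⟩⟩
  · simpa using LinearMap.congr_fun h ⟨1, trivial⟩
  · ext ⟨j, hj⟩
    have h := f.map_smul j ⟨1, trivial⟩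
    rw [show j • (⟨1, trivial⟩ : (⊤ : Ideal R)) = ⟨j, hj⟩ by ext; simp] at h
    simp [h, mul_comm]

variable [IsDomain R]

/-- In a domain, a finitely generated ideal `J` is a GV-ideal iff it is nonzero and `J⁻¹ = R`;
the latter condition is expressed here through divisibility. -/
theorem isGVIdeal_iff {J : Ideal R} :
    IsGVIdeal J ↔ J.FG ∧ J ≠ ⊥ ∧ ∀ a b : R, b ≠ 0 → (∀ j ∈ J, b ∣ a * j) → b ∣ a := by
  refine and_congr_right fun _ => ⟨fun h => ?_, fun h => ?_⟩
  · have hJ : J ≠ ⊥ := by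
      rintro rfl
      refine one_ne_zero (h.1 (a₁ := (1 : R)) (a₂ := 0) ?_)
      ext ⟨x, hx⟩
      simpa using hx
    refine ⟨hJ, fun a b hb hab => ?_⟩
    choose q hq using fun j : J => hab j j.2
    let f : J →ₗ[R] R :=
      { toFun := q
        map_add' := fun x y => mul_left_cancel₀ hb <| by
          rw [mul_add, ← hq, ← hq, ← hq, Submodule.coe_add, mul_add]
        map_smul' := fun r x => mul_left_cancel₀ hb <| by
          rw [← hq, RingHom.id_apply, Submodule.coe_smul, smul_eq_mul, smul_eq_mul,
            mul_left_comm, hq, mul_left_comm] }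
    obtain ⟨r, hr⟩ := h.2 f
    obtain ⟨j, hj, hj0⟩ := Submodule.exists_mem_ne_zero_of_ne_bot hJ
    have h1 : r * j = q ⟨j, hj⟩ := LinearMap.congr_fun hr ⟨j, hj⟩
    refine ⟨r, mul_right_cancel₀ hj0 ?_⟩
    rw [mul_assoc, h1, ← hq]
  · obtain ⟨hJ, hdvd⟩ := h
    obtain ⟨j₀, hj₀, hj0⟩ := Submodule.exists_mem_ne_zero_of_ne_bot hJ
    refine ⟨fun r s h => mul_right_cancel₀ hj0 ?_, fun f => ?_⟩
    · simpa using LinearMap.congr_fun h ⟨j₀, hj₀⟩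
    · have key (j : J) : f ⟨j₀, hj₀⟩ * j = j₀ * f j := by
        rw [mul_comm, ← smul_eq_mul, ← f.map_smul, ← smul_eq_mul, ← f.map_smul]
        congr 1
        ext
        simp [mul_comm]
      obtain ⟨r, hr⟩ := hdvd _ _ hj0 fun j hj => ⟨_, key ⟨j, hj⟩⟩
      refine ⟨r, LinearMap.ext fun j => mul_left_cancel₀ hj0 ?_⟩
      rw [← key, hr]
      simp [mul_assoc]

theorem IsGVIdeal.mul {I J : Ideal R} (hI : IsGVIdeal I) (hJ : IsGVIdeal J) :
    IsGVIdeal (I * J) := by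
  rw [isGVIdeal_iff] at *
  refine ⟨hI.1.mul hJ.1, mul_ne_zero hI.2.1 hJ.2.1, fun a b hb h => ?_⟩
  refine hI.2.2 a b hb fun i hi => hJ.2.2 _ b hb fun j hj => ?_
  rw [mul_assoc]
  exact h _ (Ideal.mul_mem_mul hi hj)

/-- The ideals containing a GV-ideal are closed under the Gabriel topology axiom. -/
theorem IsGVIdeal.exists_le_of_forall_mul_mem {J A : Ideal R} (hJ : IsGVIdeal J)
    (h : ∀ j ∈ J, ∃ J' : Ideal R, IsGVIdeal J' ∧ ∀ j' ∈ J', j * j' ∈ A) :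
    ∃ J' : Ideal R, IsGVIdeal J' ∧ J' ≤ A := by
  suffices ∀ I : Ideal R, I.FG → I ≤ J → ∃ J' : Ideal R, IsGVIdeal J' ∧ I * J' ≤ A by
    obtain ⟨J', hJ', hle⟩ := this J hJ.1 le_rfl
    exact ⟨J * J', hJ.mul hJ', hle⟩
  intro I hI
  induction I, hI using Submodule.fg_induction with
  | singleton x =>
    intro hx
    obtain ⟨J', hJ', hle⟩ := h x (hx (Submodule.mem_span_singleton_self x))
    refine ⟨J', hJ', Ideal.mul_le.2 fun r hr s hs => ?_⟩
    obtain ⟨c, rfl⟩ := Submodule.mem_span_singleton.1 hr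
    rw [smul_eq_mul, mul_assoc]
    exact A.mul_mem_left c (hle s hs)
  | sup I₁ I₂ h₁ h₂ ih₁ ih₂ =>
    intro hle
    obtain ⟨J₁, hJ₁, hle₁⟩ := ih₁ (le_sup_left.trans hle)
    obtain ⟨J₂, hJ₂, hle₂⟩ := ih₂ (le_sup_right.trans hle)
    refine ⟨J₁ * J₂, hJ₁.mul hJ₂, ?_⟩
    rw [Ideal.sup_mul]
    exact sup_le ((Ideal.mul_mono_right Ideal.mul_le_left).trans hle₁)
      ((Ideal.mul_mono_right Ideal.mul_le_right).trans hle₂)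

end GVIdeal

section PvMD

variable {R : Type*} [CommRing R] [IsDomain R]

/-- A domain is a PvMD iff for every finite family `a` there is a GV-ideal whose elements `j`
admit a matrix `C` with proportional columns (`C k i = q k * a i` with `q k ∈ I⁻¹`, `I` the ideal
generated by `a`) and `∑ k, a k * C k i = j * a i`. -/
theorem isPvMD_iff_exists_matrix (K : Type*) [Field K] [Algebra R K] [IsFractionRing R K] :
    IsPvMD R K ↔ ∀ (n : ℕ) (a : Fin n → R), a ≠ 0 → ∃ J : Ideal R, IsGVIdeal J ∧ ∀ j ∈ J,
      ∃ C : Fin n → Fin n → R, (∀ i, ∑ k, a k * C k i = j * a i) ∧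
        ∀ k i i', a i' * C k i = a i * C k i' := by
  have inj := IsFractionRing.injective R K
  refine ⟨fun h n a ha => ?_, fun h I hI hfg => ?_⟩
  · set I : Ideal R := Ideal.span (Set.range a) with hIdef
    have haI (i) : a i ∈ I := Ideal.subset_span ⟨i, rfl⟩
    have hI : I ≠ ⊥ := by
      rintro hI
      exact ha (funext fun i => by simpa [hI] using haI i)
    have hI' : (I : FractionalIdeal (nonZeroDivisors R) K) ≠ 0 :=
      FractionalIdeal.coeIdeal_ne_zero.2 hI
    obtain ⟨J, hJ, hle⟩ := h I hI ⟨(Set.finite_range a).toFinset, by simp [hIdef, Ideal.span]⟩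
    refine ⟨J, hJ, fun j hj => ?_⟩
    have hmem := hle (FractionalIdeal.mem_coeIdeal_of_mem (nonZeroDivisors R) hj)
    obtain ⟨q, hq, hsum⟩ : ∃ q : Fin n → K,
        (∀ k, q k ∈ (I : FractionalIdeal (nonZeroDivisors R) K)⁻¹) ∧
          ∑ k, algebraMap R K (a k) * q k = algebraMap R K j := by
      refine FractionalIdeal.mul_induction_on hmem (fun x hx y hy => ?_) fun x y hx hy => ?_
      · obtain ⟨x, hxI, rfl⟩ := (FractionalIdeal.mem_coeIdeal _).1 hx
        obtain ⟨c, rfl⟩ := (Submodule.mem_span_range_iff_exists_fun R).1 hxI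
        refine ⟨fun k => c k • y, fun k => Submodule.smul_mem _ _ hy, ?_⟩
        rw [map_sum, Finset.sum_mul]
        exact Finset.sum_congr rfl fun k _ => by
          simp only [smul_eq_mul, map_mul, Algebra.smul_def]
          ring
      · obtain ⟨q, hq, hx⟩ := hx
        obtain ⟨q', hq', hy⟩ := hy
        refine ⟨q + q', fun k => Submodule.add_mem _ (hq k) (hq' k), ?_⟩
        simp [mul_add, Finset.sum_add_distrib, hx, hy]
    have hC (k i) : ∃ c : R, algebraMap R K c = q k * algebraMap R K (a i) :=
      (FractionalIdeal.mem_one_iff _).1 ((FractionalIdeal.mem_inv_iff hI').1 (hq k) _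
        (FractionalIdeal.mem_coeIdeal_of_mem _ (haI i)))
    choose C hC using hC
    refine ⟨C, fun i => inj ?_, fun k i i' => inj ?_⟩
    · simp only [map_sum, map_mul, hC, ← hsum, Finset.sum_mul, mul_assoc]
    · simp only [map_mul, hC]
      ring
  · obtain ⟨n, a, rfl⟩ := Submodule.fg_iff_exists_fin_generating_family.1 hfg
    have ha : a ≠ 0 := by
      rintro rfl
      exact hI (by simp)
    obtain ⟨J, hJ, hC⟩ := h n a ha
    obtain ⟨i₀, hi₀⟩ := Function.ne_iff.1 ha
    have hd : algebraMap R K (a i₀) ≠ 0 := fun h0 => hi₀ (inj (by simpa using h0))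
    refine ⟨J, hJ, fun x hx => ?_⟩
    obtain ⟨j, hj, rfl⟩ := (FractionalIdeal.mem_coeIdeal _).1 hx
    obtain ⟨C, hsum, hprop⟩ := hC j hj
    have hj' : algebraMap R K j =
        ∑ k, algebraMap R K (a k) * (algebraMap R K (C k i₀) / algebraMap R K (a i₀)) := by
      rw [← mul_left_inj' hd, ← map_mul, ← hsum, map_sum, Finset.sum_mul]
      refine Finset.sum_congr rfl fun k _ => ?_
      rw [map_mul]
      field_simp
    rw [hj']
    refine Submodule.sum_mem _ fun k _ => FractionalIdeal.mul_mem_mul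
      (FractionalIdeal.mem_coeIdeal_of_mem _ (Submodule.subset_span ⟨k, rfl⟩)) ?_
    rw [FractionalIdeal.mem_inv_iff (FractionalIdeal.coeIdeal_ne_zero.2 hI)]
    intro y hy
    obtain ⟨y, hyI, rfl⟩ := (FractionalIdeal.mem_coeIdeal _).1 hy
    obtain ⟨c, rfl⟩ := (Submodule.mem_span_range_iff_exists_fun R).1 hyI
    refine (FractionalIdeal.mem_one_iff _).2 ⟨∑ i, c i * C k i, ?_⟩
    rw [map_sum, map_sum, Finset.mul_sum]
    refine Finset.sum_congr rfl fun i _ => ?_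
    have := congrArg (algebraMap R K) (hprop k i i₀)
    simp only [map_mul, smul_eq_mul] at this ⊢
    field_simp
    linear_combination algebraMap R K (c i) * this

end PvMD

section Torsion

variable {R : Type*} [CommRing R] [IsDomain R] {M : Type*} [AddCommGroup M] [Module R M]

theorem mem_torsion_of_smul_mem {r : R} (hr : r ≠ 0) {m : M}
    (h : r • m ∈ Submodule.torsion R M) : m ∈ Submodule.torsion R M := by
  obtain ⟨⟨s, hs⟩, h⟩ := h
  refine ⟨⟨s * r, mul_mem hs (mem_nonZeroDivisors_of_ne_zero hr)⟩, ?_⟩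
  rw [Submonoid.mk_smul] at h ⊢
  rw [mul_smul, h]

/-- Over a PvMD, a vector solving a linear system modulo torsion is, up to multiplication by the
elements of a GV-ideal, congruent modulo torsion to an exact solution. -/
theorem IsPvMD.exists_smul_sub_mem_torsion {K : Type*} [Field K] [Algebra R K]
    [IsFractionRing R K] (h : IsPvMD R K) {p : ℕ} (m : Fin p → M) (n : ℕ)
    (A : Fin n → Fin p → R) (hA : ∀ i, ∑ k, A i k • m k ∈ Submodule.torsion R M) :
    ∃ J : Ideal R, IsGVIdeal J ∧ ∀ j ∈ J, ∃ s : Fin p → M,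
      (∀ i, ∑ k, A i k • s k = 0) ∧ ∀ k, j • m k - s k ∈ Submodule.torsion R M := by
  induction n with
  | zero => exact ⟨⊤, isGVIdeal_top, fun j _ => ⟨j • m, finZeroElim, fun k => by simp⟩⟩
  | succ n ih =>
    by_cases ha : A 0 = 0
    · obtain ⟨J, hJ, hs⟩ := ih (fun i => A i.succ) fun i => hA i.succ
      refine ⟨J, hJ, fun j hj => ?_⟩
      obtain ⟨s, hs, hs'⟩ := hs j hj
      exact ⟨s, Fin.cases (by simp [ha]) hs, hs'⟩
    obtain ⟨J, hJ, hC⟩ := (isPvMD_iff_exists_matrix K).1 h p (A 0) ha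
    obtain ⟨i₀, hi₀⟩ := Function.ne_iff.1 ha
    let S : Submodule R (Fin p → M) :=
      { carrier := {s | ∀ i, ∑ k, A i k • s k = 0}
        add_mem' := fun {x y} hx hy i => by simp [Finset.sum_add_distrib, hx i, hy i]
        zero_mem' := by simp
        smul_mem' := fun r x hx i => by
          simp [smul_comm _ r, ← Finset.smul_sum, hx i] }
    let N : Submodule R (Fin p → M) :=
      S ⊔ Submodule.pi Set.univ fun _ => Submodule.torsion R M
    suffices ∃ J : Ideal R, IsGVIdeal J ∧ J ≤ N.comap (LinearMap.toSpanSingleton R _ m) by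
      obtain ⟨J, hJ, hle⟩ := this
      refine ⟨J, hJ, fun j hj => ?_⟩
      obtain ⟨s, hs, t, ht, hst⟩ := Submodule.mem_sup.1 (Submodule.mem_comap.1 (hle hj))
      refine ⟨s, hs, fun k => ?_⟩
      have := congrFun hst k
      simp only [Pi.add_apply, LinearMap.toSpanSingleton_apply, Pi.smul_apply] at this
      rw [← this, add_sub_cancel_left]
      exact ht k trivial
    refine hJ.exists_le_of_forall_mul_mem fun j hj => ?_
    obtain ⟨C, hsum, hprop⟩ := hC j hj
    let B (x : Fin p → M) (k : Fin p) : M := j • x k - ∑ i, C k i • x i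
    have hAB (x : Fin p → M) : ∑ k, A 0 k • B x k = 0 := by
      simp only [B, smul_sub, Finset.sum_sub_distrib, Finset.smul_sum, smul_smul]
      rw [Finset.sum_comm (γ := Fin p)]
      simp only [← Finset.sum_smul, hsum, mul_comm j, sub_self]
    have hCm (k) : ∑ i, C k i • m i ∈ Submodule.torsion R M := by
      refine mem_torsion_of_smul_mem hi₀ ?_
      have : A 0 i₀ • ∑ i, C k i • m i = C k i₀ • ∑ i, A 0 i • m i := by
        simp only [Finset.smul_sum, smul_smul, hprop k _ i₀, mul_comm (C k i₀)]
      rw [this]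
      exact Submodule.smul_mem _ _ (hA 0)
    have hB (x : Fin p → M) (i : Fin n) :
        ∑ k, (j * A i.succ k - ∑ l, A i.succ l * C l k) • x k = ∑ k, A i.succ k • B x k := by
      simp only [B, sub_smul, smul_sub, Finset.sum_sub_distrib, Finset.smul_sum, smul_smul,
        Finset.sum_smul]
      rw [Finset.sum_comm (γ := Fin p)]
      simp only [mul_comm j]
    obtain ⟨J', hJ', hs⟩ := ih (fun i k => j * A i.succ k - ∑ l, A i.succ l * C l k) fun i => by
      simp only [hB, B, smul_sub, Finset.sum_sub_distrib, smul_comm _ j, ← Finset.smul_sum]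
      exact Submodule.sub_mem _ (Submodule.smul_mem _ _ (hA _))
        (Submodule.sum_mem _ fun k _ => Submodule.smul_mem _ _ (hCm k))
    refine ⟨J', hJ', fun j' hj' => ?_⟩
    obtain ⟨s, hs, hst⟩ := hs j' hj'
    refine Submodule.mem_sup.2 ⟨B s, Fin.cases (hAB s) fun i => (hB s i).symm.trans (hs i),
      (j * j') • m - B s, fun k _ => ?_, by simp⟩
    have : ((j * j') • m - B s) k = j • (j' • m k - s k) -
        ∑ i, C k i • (j' • m i - s i) + j' • ∑ i, C k i • m i := by
      simp only [B, Pi.sub_apply, Pi.smul_apply, smul_sub, Finset.sum_sub_distrib, mul_smul,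
        smul_comm _ j', ← Finset.smul_sum]
      abel
    rw [this]
    exact add_mem (sub_mem (Submodule.smul_mem _ _ (hst k))
      (Submodule.sum_mem _ fun i _ => Submodule.smul_mem _ _ (hst i)))
      (Submodule.smul_mem _ _ (hCm k))

end Torsion

section Tensor

variable {R : Type*} [CommRing R] {L N : Type*} [AddCommGroup L] [Module R L]
  [AddCommGroup N] [Module R N]

theorem exists_sum_tmul_eq_of_span_eq_top {n : ℕ} {l : Fin n → L}
    (hl : Submodule.span R (Set.range l) = ⊤) (x : L ⊗[R] N) :
    ∃ t : Fin n → N, x = ∑ i, l i ⊗ₜ[R] t i := by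
  induction x with
  | zero => exact ⟨0, by simp⟩
  | tmul y t =>
    obtain ⟨c, rfl⟩ := (Submodule.mem_span_range_iff_exists_fun R).1
      (hl ▸ Submodule.mem_top : y ∈ Submodule.span R (Set.range l))
    exact ⟨fun i => c i • t, by simp [TensorProduct.sum_tmul, TensorProduct.smul_tmul]⟩
  | add x y hx hy =>
    obtain ⟨t, rfl⟩ := hx
    obtain ⟨t', rfl⟩ := hy
    exact ⟨t + t', by simp [TensorProduct.tmul_add, Finset.sum_add_distrib]⟩

/-- An element of `L ⊗ N` killed by `L ⊗ f` comes from an element of `L' ⊗ N` killed by `L' ⊗ f`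
for some finitely generated submodule `L'` of `L`. -/
theorem exists_fg_lTensor_eq_zero {M : Type*} [AddCommGroup M] [Module R M] (f : N →ₗ[R] M)
    {x : L ⊗[R] N} (hx : f.lTensor L x = 0) :
    ∃ (L' : Submodule R L) (y : L' ⊗[R] N), L'.FG ∧ f.lTensor L' y = 0 ∧
      L'.subtype.rTensor N y = x := by
  obtain ⟨P, hP, y, rfl⟩ := Submodule.exists_fg_le_eq_rTensor_subtype (N := L) (M := N) x
  have hcomm {X Y : Type _} [AddCommGroup X] [Module R X] [AddCommGroup Y] [Module R Y]
      (g : X →ₗ[R] Y) (z : X ⊗[R] N) :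
      f.lTensor Y (g.rTensor N z) = g.rTensor M (f.lTensor X z) := by
    rw [← LinearMap.comp_apply, ← LinearMap.comp_apply, LinearMap.lTensor_comp_rTensor,
      LinearMap.rTensor_comp_lTensor]
  rw [hcomm] at hx
  obtain ⟨L', hL', hle, hy⟩ := hP.exists_rTensor_fg_inclusion_eq (x := f.lTensor P y) (y := 0)
    (by rw [hx, map_zero])
  refine ⟨L', (Submodule.inclusion hle).rTensor N y, hL', ?_, ?_⟩
  · rw [hcomm, hy, map_zero]
  · rw [← LinearMap.rTensor_comp_apply, Submodule.subtype_comp_inclusion]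

end Tensor

theorem IsPvMD.isGVTorsionElem_of_lTensor_eq_zero {R : Type*} [CommRing R] [IsDomain R]
    {K : Type*} [Field K] [Algebra R K] [IsFractionRing R K] (h : IsPvMD R K) {M L : Type*} [AddCommGroup M] [Module R M]
    [AddCommGroup L] [Module R L] {x : L ⊗[R] Submodule.torsion R M}
    (hx : (Submodule.torsion R M).subtype.lTensor L x = 0) : IsGVTorsionElem R x := by
  obtain ⟨L', y, hfg, hy, rfl⟩ := exists_fg_lTensor_eq_zero _ hx
  obtain ⟨n, l, hl⟩ := Submodule.fg_iff_exists_fin_generating_family.1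
    (Module.Finite.iff_fg.2 hfg).fg_top
  obtain ⟨t, rfl⟩ := exists_sum_tmul_eq_of_span_eq_top hl y
  simp only [map_sum, LinearMap.lTensor_tmul, Submodule.subtype_apply] at hy
  obtain ⟨p, A, m, htm, hAl⟩ := TensorProduct.vanishesTrivially_of_sum_tmul_eq_zero R hl hy
  obtain ⟨J, hJ, hs⟩ := h.exists_smul_sub_mem_torsion m n A fun i => htm i ▸ (t i).2
  refine ⟨J, hJ, fun j hj => ?_⟩
  obtain ⟨s, hs, hst⟩ := hs j hj
  rw [← map_smul, Finset.smul_sum]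
  simp only [← TensorProduct.tmul_smul]
  rw [TensorProduct.sum_tmul_eq_zero_of_vanishesTrivially R
    ⟨p, A, fun k => ⟨_, hst k⟩, fun i => Subtype.ext ?_, hAl⟩, map_zero]
  simp only [Submodule.coe_smul, Submodule.coe_sum, smul_sub, Finset.sum_sub_distrib, hs, htm,
    smul_comm _ j, ← Finset.smul_sum, sub_zero]

/-- If torsion submodules are `w`-pure then `R` is a PvMD: it suffices to test
`M = Rⁿ / d K` and `L = Rⁿ / (d Rⁿ + R a)`, where `K` is the module of relations of `a` and
`d` is a nonzero entry of `a`. -/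
theorem isPvMD_of_isGVTorsionElem {R : Type u} [CommRing R] [IsDomain R]
    (K : Type*) [Field K] [Algebra R K] [IsFractionRing R K]
    (h : ∀ (M : Type u) [AddCommGroup M] [Module R M] (L : Type u) [AddCommGroup L] [Module R L]
      (x : L ⊗[R] Submodule.torsion R M),
      (Submodule.torsion R M).subtype.lTensor L x = 0 → IsGVTorsionElem R x) :
    IsPvMD R K := by
  refine (isPvMD_iff_exists_matrix K).2 fun n a ha => ?_
  obtain ⟨i₀, hd⟩ := Function.ne_iff.1 ha
  set d := a i₀ with hd_def
  let φ : (Fin n → R) →ₗ[R] R := Fintype.linearCombination R a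
  have hφ (i : Fin n) : φ (Pi.single i 1) = a i := by simp [φ]
  let D : Submodule R (Fin n → R) := φ.ker.map (LinearMap.lsmul R (Fin n → R) d)
  let E : Submodule R (Fin n → R) :=
    (LinearMap.lsmul R (Fin n → R) d).range ⊔ Submodule.span R {a}
  let e (i : Fin n) : (Fin n → R) ⧸ E := E.mkQ (Pi.single i 1)
  have sum_e (c : Fin n → R) : ∑ i, c i • e i = E.mkQ c := by
    simp only [e, ← map_smul, ← map_sum]
    rw [← pi_eq_sum_univ' c]
  have he : Submodule.span R (Set.range e) = ⊤ := by
    refine eq_top_iff.2 fun y _ => ?_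
    obtain ⟨c, rfl⟩ := E.mkQ_surjective y
    rw [← sum_e]
    exact Submodule.sum_mem _ fun i _ => Submodule.smul_mem _ _ (Submodule.subset_span ⟨i, rfl⟩)
  let κ (i : Fin n) : Fin n → R := a i • Pi.single i₀ 1 - d • Pi.single i 1
  have hκ (i) : φ (κ i) = 0 := by simp [κ, hφ, hd_def, mul_comm]
  have hκT (i) : D.mkQ (κ i) ∈ Submodule.torsion R ((Fin n → R) ⧸ D) :=
    ⟨⟨d, mem_nonZeroDivisors_of_ne_zero hd⟩, by
      rw [Submonoid.mk_smul, ← map_smul, Submodule.mkQ_apply, Submodule.Quotient.mk_eq_zero]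
      exact ⟨κ i, hκ i, rfl⟩⟩
  obtain ⟨J, hJ, hx⟩ := h ((Fin n → R) ⧸ D) ((Fin n → R) ⧸ E)
    (∑ i, e i ⊗ₜ[R] ⟨D.mkQ (κ i), hκT i⟩) (by
      have h1 : ∑ i, a i • e i = 0 := by
        rw [sum_e, Submodule.mkQ_apply, Submodule.Quotient.mk_eq_zero]
        exact Submodule.mem_sup_right (Submodule.mem_span_singleton_self a)
      have h2 (i) : d • e i = 0 := by
        rw [← map_smul, Submodule.mkQ_apply, Submodule.Quotient.mk_eq_zero]
        exact Submodule.mem_sup_left ⟨Pi.single i 1, rfl⟩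
      simp only [map_sum, LinearMap.lTensor_tmul, Submodule.subtype_apply, κ, map_sub, map_smul,
        TensorProduct.tmul_sub, ← TensorProduct.smul_tmul, h2, TensorProduct.zero_tmul, sub_zero,
        ← TensorProduct.sum_tmul, h1])
  refine ⟨J, hJ, fun j hj => ?_⟩
  have hxj := hx j hj
  simp only [Finset.smul_sum, ← TensorProduct.tmul_smul] at hxj
  obtain ⟨p, b, y, hby, hbe⟩ := TensorProduct.vanishesTrivially_of_sum_tmul_eq_zero R he hxj
  have hu (l) : ∃ u : Fin n → R, φ u = 0 ∧ D.mkQ u = y l := by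
    obtain ⟨u, hu⟩ := D.mkQ_surjective (y l)
    obtain ⟨⟨r, hr⟩, hry⟩ := (y l).2
    rw [Submonoid.mk_smul, ← hu, ← map_smul, Submodule.mkQ_apply,
      Submodule.Quotient.mk_eq_zero] at hry
    obtain ⟨v, hv, hvu⟩ := hry
    have := congrArg φ hvu
    rw [LinearMap.lsmul_apply, map_smul, map_smul, LinearMap.mem_ker.1 hv, smul_zero,
      eq_comm, smul_eq_mul] at this
    exact ⟨u, (mul_eq_zero.1 this).resolve_left (nonZeroDivisors.ne_zero hr), hu⟩
  choose u hφu hu using hu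
  have hb (l) : ∃ (c : Fin n → R) (r : R), ∀ i, b i l = d * c i + r * a i := by
    have := hbe l
    rw [sum_e, Submodule.mkQ_apply, Submodule.Quotient.mk_eq_zero] at this
    obtain ⟨_, ⟨c, rfl⟩, _, hr, hcr⟩ := Submodule.mem_sup.1 this
    obtain ⟨r, rfl⟩ := Submodule.mem_span_singleton.1 hr
    exact ⟨c, r, fun i => by simpa using (congrFun hcr i).symm⟩
  choose c r hb using hb
  have hv (i) : ∃ v : Fin n → R, j • κ i - ∑ l, b i l • u l = d • v := by
    have := congrArg Subtype.val (hby i)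
    simp only [Submodule.coe_smul, Submodule.coe_sum, ← hu, ← map_smul, ← map_sum] at this
    rw [← sub_eq_zero, ← map_sub, Submodule.mkQ_apply, Submodule.Quotient.mk_eq_zero] at this
    obtain ⟨v, -, hv⟩ := this
    exact ⟨v, hv.symm⟩
  choose v hv using hv
  let z : Fin n → R := j • Pi.single i₀ 1 - ∑ l, r l • u l
  let w (i : Fin n) : Fin n → R := j • Pi.single i 1 + ∑ l, c l i • u l + v i
  have hzw (i) : a i • z = d • w i := by
    simp only [z, w, smul_add, ← hv, κ, hb, add_smul, Finset.sum_add_distrib, mul_smul, smul_sub,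
      ← Finset.smul_sum, smul_comm _ (a i), smul_comm _ d]
    abel
  have hφz : ∑ k, z k * a k = j * d := by
    have : φ z = j * d := by simp [z, hφ, hφu, ← hd_def]
    rw [← this]
    simp [φ, Fintype.linearCombination_apply]
  have hzw' (i k) : a i * z k = d * w i k := congrFun (hzw i) k
  refine ⟨fun k i => w i k, fun i => mul_left_cancel₀ hd ?_,
    fun k i i' => mul_left_cancel₀ hd ?_⟩
  · calc d * ∑ k, a k * w i k = a i * ∑ k, z k * a k := by
          simp only [Finset.mul_sum]
          exact Finset.sum_congr rfl fun k _ => by linear_combination -a k * hzw' i k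
      _ = d * (j * a i) := by rw [hφz]; ring
  · linear_combination a i * hzw' i' k - a i' * hzw' i k

/-- `R` is a PvMD iff for every `R`-module `M` the torsion submodule
`T(M)` is a `w`-pure submodule of `M`, i.e. for every `R`-module `L` the kernel of
`L ⊗ T(M) → L ⊗ M` is GV-torsion. -/
theorem pvmd_iff_torsion_submodule_wpure
    {R : Type u} [CommRing R] [IsDomain R] :
    IsPvMD R (FractionRing R) ↔
      ∀ (M : Type u) [AddCommGroup M] [Module R M]
        (L : Type u) [AddCommGroup L] [Module R L],
        ∀ x ∈ LinearMap.ker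
            (LinearMap.lTensor L (Submodule.torsion R M).subtype),
          IsGVTorsionElem R x := by
  exact ⟨fun h M _ _ L _ _ x hx => h.isGVTorsionElem_of_lTensor_eq_zero hx,
    isPvMD_of_isGVTorsionElem _⟩
end

section
/- Let R be a commutative ring and 0 → A →f→ B →g→ C → 0 a short exact sequence of R-modules that w-splits, i.e., there exists a GV-ideal J such that for every d ∈ J there is an R-homomorphism h : C → B with g ∘ h = d·id_C. Then the sequence is w-pure: for every R-module L, the kernel of id_L ⊗ f : L ⊗_R A → L ⊗_R B is GV-torsion. -/
open TensorProduct

/-- If `d • id` on `C` lifts along `g`, then `d • id` on `A = ker g` extends along `f`. -/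
theorem exists_retraction_up_to_smul {R A B C : Type*} [CommRing R]
    [AddCommGroup A] [Module R A] [AddCommGroup B] [Module R B]
    [AddCommGroup C] [Module R C] (f : A →ₗ[R] B) (g : B →ₗ[R] C)
    (hf : Function.Injective f) (hexact : LinearMap.ker g = LinearMap.range f)
    (d : R) (h : C →ₗ[R] B) (hh : g ∘ₗ h = d • LinearMap.id) :
    ∃ k : B →ₗ[R] A, k ∘ₗ f = d • LinearMap.id := by
  have hgf (a : A) : g (f a) = 0 := by
    rw [← LinearMap.mem_ker, hexact]
    exact LinearMap.mem_range_self f a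
  have hrange (b : B) : (d • LinearMap.id - h ∘ₗ g : B →ₗ[R] B) b ∈ LinearMap.range f := by
    have hb : g (h (g b)) = d • g b := LinearMap.congr_fun hh (g b)
    rw [← hexact, LinearMap.mem_ker]
    simp [hb]
  refine ⟨(LinearEquiv.ofInjective f hf).symm.toLinearMap ∘ₗ
    LinearMap.codRestrict (LinearMap.range f) (d • LinearMap.id - h ∘ₗ g) hrange, ?_⟩
  ext a
  apply (LinearEquiv.ofInjective f hf).injective
  ext
  simp [hgf]

/-- every `w`-split short exact sequence is `w`-pure. -/
theorem wsplit_shortExact_is_wpure {R : Type u} [CommRing R]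
    {A B C : Type u} [AddCommGroup A] [Module R A] [AddCommGroup B] [Module R B]
    [AddCommGroup C] [Module R C]
    (f : A →ₗ[R] B) (g : B →ₗ[R] C)
    (hf : Function.Injective f) (hg : Function.Surjective g)
    (hexact : LinearMap.ker g = LinearMap.range f)
    (hsplit : ∃ J : Ideal R, IsGVIdeal J ∧
      ∀ d ∈ J, ∃ h : C →ₗ[R] B, g ∘ₗ h = d • LinearMap.id) :
    ∀ (L : Type u) [AddCommGroup L] [Module R L],
      ∀ x ∈ LinearMap.ker (LinearMap.lTensor L f), IsGVTorsionElem R x := by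
  obtain ⟨J, hJ, hsplit⟩ := hsplit
  intro L _ _ x hx
  refine ⟨J, hJ, fun d hd => ?_⟩
  obtain ⟨h, hh⟩ := hsplit d hd
  obtain ⟨k, hk⟩ := exists_retraction_up_to_smul f g hf hexact d h hh
  have hkx : LinearMap.lTensor L (k ∘ₗ f) x = 0 := by
    rw [LinearMap.lTensor_comp_apply, LinearMap.mem_ker.mp hx, map_zero]
  simpa [hk, LinearMap.lTensor_smul] using hkx
end

section
/- Let R be a commutative ring, Γ a directed set, and {ζ_i : 0 → A_i →f_i→ B_i →g_i→ C_i → 0}_{i∈Γ} a direct system of short exact sequences of R-modules (with compatible transition maps). If each ζ_i is w-pure, i.e., for every R-module L the kernel of id_L ⊗ f_i is GV-torsion, then the direct limit sequence 0 → lim_→ A_i →lim f_i→ lim_→ B_i →lim g_i→ lim_→ C_i → 0 is exact and w-pure: for every R-module L, the kernel of id_L ⊗ (lim_→ f_i) is GV-torsion. -/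
open TensorProduct

section DirectLimit

variable {R : Type*} [CommRing R] {Γ : Type*} [Preorder Γ] [DecidableEq Γ]
  {A B C : Γ → Type*}
  [∀ i, AddCommGroup (A i)] [∀ i, Module R (A i)]
  [∀ i, AddCommGroup (B i)] [∀ i, Module R (B i)]
  [∀ i, AddCommGroup (C i)] [∀ i, Module R (C i)]
  {a : ∀ i j, i ≤ j → A i →ₗ[R] A j}
  {b : ∀ i j, i ≤ j → B i →ₗ[R] B j}
  {c : ∀ i j, i ≤ j → C i →ₗ[R] C j}

namespace TensorProduct

variable (L : Type*) [AddCommGroup L] [Module R L]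

lemma directLimitRight_lTensor_of {i : Γ} (x : L ⊗[R] A i) :
    directLimitRight a L (LinearMap.lTensor L (Module.DirectLimit.of R Γ A a i) x) =
      Module.DirectLimit.of R Γ (fun i => L ⊗[R] A i)
        (fun i j h => LinearMap.lTensor L (a i j h)) i x := by
  induction x with
  | zero => simp
  | tmul l x => simp
  | add x y hx hy => simp only [map_add, hx, hy]

lemma exists_lTensor_of [IsDirectedOrder Γ] [Nonempty Γ]
    (x : L ⊗[R] Module.DirectLimit A a) :
    ∃ i y, LinearMap.lTensor L (Module.DirectLimit.of R Γ A a i) y = x := by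
  obtain ⟨i, y, hy⟩ := Module.DirectLimit.exists_of (directLimitRight a L x)
  exact ⟨i, y, (directLimitRight a L).injective (by rw [directLimitRight_lTensor_of, hy])⟩

lemma exists_lTensor_eq_zero [IsDirectedOrder Γ] [DirectedSystem A fun i j h => a i j h]
    {i : Γ} {x : L ⊗[R] A i}
    (hx : LinearMap.lTensor L (Module.DirectLimit.of R Γ A a i) x = 0) :
    ∃ j, ∃ hij : i ≤ j, LinearMap.lTensor L (a i j hij) x = 0 := by
  apply_fun directLimitRight a L at hx
  rw [directLimitRight_lTensor_of, map_zero] at hx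
  exact Module.DirectLimit.of.zero_exact hx

end TensorProduct

namespace Module.DirectLimit

lemma map_comp_of {f : ∀ i, A i →ₗ[R] B i}
    (hf : ∀ i j (h : i ≤ j), f j ∘ₗ a i j h = b i j h ∘ₗ f i) (i : Γ) :
    map f hf ∘ₗ of R Γ A a i = of R Γ B b i ∘ₗ f i :=
  LinearMap.ext fun _ => map_apply_of f hf _

variable [IsDirectedOrder Γ]

lemma map_injective [Nonempty Γ] [DirectedSystem B fun i j h => b i j h]
    {f : ∀ i, A i →ₗ[R] B i}
    (hf : ∀ i j (h : i ≤ j), f j ∘ₗ a i j h = b i j h ∘ₗ f i)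
    (hinj : ∀ i, Function.Injective (f i)) :
    Function.Injective (map f hf) := by
  rw [injective_iff_map_eq_zero]
  intro x hx
  obtain ⟨i, x, rfl⟩ := exists_of x
  rw [map_apply_of] at hx
  obtain ⟨j, hij, hj⟩ := of.zero_exact hx
  have hj : f j (a i j hij x) = 0 := (LinearMap.congr_fun (hf i j hij) x).trans hj
  rw [← of_f (hij := hij), (map_eq_zero_iff _ (hinj j)).mp hj, map_zero]

lemma map_surjective [Nonempty Γ] {f : ∀ i, A i →ₗ[R] B i}
    (hf : ∀ i j (h : i ≤ j), f j ∘ₗ a i j h = b i j h ∘ₗ f i)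
    (hsurj : ∀ i, Function.Surjective (f i)) :
    Function.Surjective (map f hf) := by
  intro y
  obtain ⟨i, y, rfl⟩ := exists_of y
  obtain ⟨x, rfl⟩ := hsurj i y
  exact ⟨of R Γ A a i x, map_apply_of f hf x⟩

lemma map_exact [Nonempty Γ] [DirectedSystem C fun i j h => c i j h]
    {f : ∀ i, A i →ₗ[R] B i} {g : ∀ i, B i →ₗ[R] C i}
    (hf : ∀ i j (h : i ≤ j), f j ∘ₗ a i j h = b i j h ∘ₗ f i)
    (hg : ∀ i j (h : i ≤ j), g j ∘ₗ b i j h = c i j h ∘ₗ g i)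
    (hex : ∀ i, Function.Exact (f i) (g i)) :
    Function.Exact (map f hf) (map g hg) := by
  refine fun y => ⟨fun hy => ?_, ?_⟩
  · obtain ⟨i, y, rfl⟩ := exists_of y
    rw [map_apply_of] at hy
    obtain ⟨j, hij, hj⟩ := of.zero_exact hy
    obtain ⟨x, hx⟩ := (hex j _).mp ((LinearMap.congr_fun (hg i j hij) y).trans hj)
    exact ⟨of R Γ A a j x, by rw [map_apply_of, hx, of_f]⟩
  · rintro ⟨x, rfl⟩
    obtain ⟨i, x, rfl⟩ := exists_of x
    rw [map_apply_of, map_apply_of, (hex i).apply_apply_eq_zero, map_zero]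

end Module.DirectLimit

end DirectLimit

lemma IsGVTorsionElem.map {R M N : Type*} [CommRing R] [AddCommGroup M] [Module R M]
    [AddCommGroup N] [Module R N] {m : M} (hm : IsGVTorsionElem R m) (φ : M →ₗ[R] N) :
    IsGVTorsionElem R (φ m) :=
  hm.imp fun _ hJ => ⟨hJ.1, fun j hj => by rw [← map_smul, hJ.2 j hj, map_zero]⟩

/-- the direct limit of a direct system of `w`-pure short exact sequences
is an exact and `w`-pure short exact sequence. -/
theorem directLimit_of_wpure_is_wpure {R : Type u} [CommRing R]
    {Γ : Type u} [Preorder Γ] [IsDirected Γ (· ≤ ·)] [Nonempty Γ] [DecidableEq Γ]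
    {A B C : Γ → Type u}
    [∀ i, AddCommGroup (A i)] [∀ i, Module R (A i)]
    [∀ i, AddCommGroup (B i)] [∀ i, Module R (B i)]
    [∀ i, AddCommGroup (C i)] [∀ i, Module R (C i)]
    {a : ∀ i j, i ≤ j → A i →ₗ[R] A j}
    {b : ∀ i j, i ≤ j → B i →ₗ[R] B j}
    {c : ∀ i j, i ≤ j → C i →ₗ[R] C j}
    [DirectedSystem A fun i j h => a i j h]
    [DirectedSystem B fun i j h => b i j h]
    [DirectedSystem C fun i j h => c i j h]
    (f : ∀ i, A i →ₗ[R] B i) (g : ∀ i, B i →ₗ[R] C i)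
    (hfc : ∀ i j (h : i ≤ j), f j ∘ₗ a i j h = b i j h ∘ₗ f i)
    (hgc : ∀ i j (h : i ≤ j), g j ∘ₗ b i j h = c i j h ∘ₗ g i)
    (hinj : ∀ i, Function.Injective (f i))
    (hsurj : ∀ i, Function.Surjective (g i))
    (hex : ∀ i, LinearMap.ker (g i) = LinearMap.range (f i))
    (hpure : ∀ i (L : Type u) [AddCommGroup L] [Module R L],
      ∀ x ∈ LinearMap.ker (LinearMap.lTensor L (f i)), IsGVTorsionElem R x) :
    Function.Injective (Module.DirectLimit.map f hfc) ∧
    Function.Surjective (Module.DirectLimit.map g hgc) ∧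
    LinearMap.ker (Module.DirectLimit.map g hgc) =
      LinearMap.range (Module.DirectLimit.map f hfc) ∧
    ∀ (L : Type u) [AddCommGroup L] [Module R L],
      ∀ x ∈ LinearMap.ker (LinearMap.lTensor L (Module.DirectLimit.map f hfc)),
        IsGVTorsionElem R x := by
  refine ⟨Module.DirectLimit.map_injective hfc hinj, Module.DirectLimit.map_surjective hgc hsurj,
    (Module.DirectLimit.map_exact hfc hgc fun i =>
      LinearMap.exact_iff.mpr (hex i)).linearMap_ker_eq, fun L _ _ x hx => ?_⟩
  obtain ⟨i, y, rfl⟩ := exists_lTensor_of L x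
  rw [LinearMap.mem_ker, ← LinearMap.lTensor_comp_apply, Module.DirectLimit.map_comp_of,
    LinearMap.lTensor_comp_apply] at hx
  obtain ⟨j, hij, hj⟩ := exists_lTensor_eq_zero L hx
  rw [← LinearMap.lTensor_comp_apply, ← hfc, LinearMap.lTensor_comp_apply] at hj
  have hof : Module.DirectLimit.of R Γ A a i = Module.DirectLimit.of R Γ A a j ∘ₗ a i j hij :=
    LinearMap.ext fun _ => Module.DirectLimit.of_f.symm
  rw [hof, LinearMap.lTensor_comp_apply]
  exact (hpure j L _ hj).map _
end
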